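/- arXiv:2605.24443 — 2 statements merged into one kernel-verified Lean document; each statement's English description precedes it below -/
import Mathlib

section
/- Two-parameter second-variation inequality at a Hessian maximum. Let n ≥ 1 be an integer and d, D reals with n ≤ d ≤ D < ∞. Let V, W : ℝⁿ → ℝ be smooth with V > −d and W > −D pointwise, let Z_V, Z_W > 0 be constants, and let φ : ℝⁿ → ℝ be smooth and convex such that for every x ∈ ℝⁿ the Monge–Ampère equation (Z_V/Z_W)^{1/d} · det(D²φ(x))^{1/d} = exp( (Θ_D(W(∇φ(x))) − Θ_d(V(x)))/d ) holds, where det(D²φ(x)) is the determinant of the Hessian matrix of φ in an orthonormal basis. Assume the function (x, e) ↦ ⟨D²φ(x)e, e⟩ on ℝⁿ × S^{n−1} attains its maximum at (x̄, e₁). Set ȳ = ∇φ(x̄), λ = ⟨D²φ(x̄)e₁, e₁⟩, V₁ = ⟨∇V(x̄), e₁⟩, V₁₁ = ⟨D²V(x̄)e₁, e₁⟩, W₁ = ⟨∇W(ȳ), e₁⟩, W₁₁ = ⟨D²W(ȳ)e₁, e₁⟩, and abbreviate V = V(x̄), W = W(ȳ). Then 0 ≥ (D/(D+W))·W₁₁·λ²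 − (d/(d+V))·V₁₁ + (2d/(d+V)²)·V₁² + (D(D−d)/(d(D+W)²))·W₁²·λ² − (2D/((d+V)(D+W)))·V₁·W₁·λ. -/
open MeasureTheory Metric Set
open scoped ENNReal RealInnerProductSpace

noncomputable section

/-- Euclidean space `ℝⁿ`. -/
abbrev Euc (n : ℕ) := EuclideanSpace ℝ (Fin n)

/-- The second directional derivative `⟨D²f(x)v, v⟩`. -/
def hess {n : ℕ} (f : Euc n → ℝ) (x v : Euc n) : ℝ :=
  iteratedFDeriv ℝ 2 f x ![v, v]

/-- The normalization constant `Z_{U,p} = ∫ (1 + U(x)/p)^(−p) dx`. -/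
def Znorm {n : ℕ} (U : Euc n → ℝ) (p : ℝ) : ℝ :=
  ∫ x, (1 + U x / p) ^ (-p)

/-- The measure `μ_{U,p}` with density `Z_{U,p}⁻¹ (1 + U(x)/p)^(−p)` w.r.t. Lebesgue. -/
def muUP {n : ℕ} (U : Euc n → ℝ) (p : ℝ) : Measure (Euc n) :=
  volume.withDensity fun x => ENNReal.ofReal ((Znorm U p)⁻¹ * (1 + U x / p) ^ (-p))

/-- The ratio `(p + U(x))/(p + |x|²)`. -/
def ratio0 {n : ℕ} (U : Euc n → ℝ) (p : ℝ) (x : Euc n) : ℝ :=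
  (p + U x) / (p + ‖x‖ ^ 2)

/-- The ratio `|∇U(x)|²/(√p + |x|)²`. -/
def ratio1 {n : ℕ} (U : Euc n → ℝ) (p : ℝ) (x : Euc n) : ℝ :=
  ‖gradient U x‖ ^ 2 / (Real.sqrt p + ‖x‖) ^ 2

/-- `c⁽⁰⁾_{U,p}(S) = inf_{x ∈ S} (p + U(x))/(p + |x|²)`. -/
def cLow {n : ℕ} (U : Euc n → ℝ) (p : ℝ) (S : Set (Euc n)) : ℝ := sInf (ratio0 U p '' S)

/-- `C⁽⁰⁾_{U,p}(S) = sup_{x ∈ S} (p + U(x))/(p + |x|²)`. -/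
def cUp {n : ℕ} (U : Euc n → ℝ) (p : ℝ) (S : Set (Euc n)) : ℝ := sSup (ratio0 U p '' S)

/-- `C⁽¹⁾_{U,p}(S) = sup_{x ∈ S} |∇U(x)|²/(√p + |x|)²`. -/
def cGrad {n : ℕ} (U : Euc n → ℝ) (p : ℝ) (S : Set (Euc n)) : ℝ := sSup (ratio1 U p '' S)

/-- The Lebesgue volume of the unit ball in `ℝⁿ`. -/
def unitBallVol (n : ℕ) : ℝ := (volume (ball (0 : Euc n) 1)).toReal

/-- `Θ_p(t) = p·log(1 + t/p)`. -/
def Theta (p t : ℝ) : ℝ := p * Real.log (1 + t / p)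

/-- The Hessian matrix of `f` at `x` in the standard orthonormal basis of `ℝⁿ`. -/
def hessMat {n : ℕ} (f : Euc n → ℝ) (x : Euc n) : Matrix (Fin n) (Fin n) ℝ :=
  Matrix.of fun i j =>
    iteratedFDeriv ℝ 2 f x ![EuclideanSpace.single i 1, EuclideanSpace.single j 1]

section SecondVariationHelpers

open Filter Topology

/-- Second-order necessary condition at a minimum. -/
lemma aux_second_min {f f' : ℝ → ℝ} {c : ℝ} (hmin : ∀ t, f 0 ≤ f t)
    (hf : ∀ t, HasDerivAt f (f' t) t) (hf' : HasDerivAt f' c 0) : 0 ≤ c := by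
  by_contra hc
  push Not at hc
  have hd : deriv f = f' := funext fun t => (hf t).deriv
  have h0 : deriv f 0 = 0 := by
    have : IsLocalMin f 0 := Filter.Eventually.of_forall hmin
    exact this.deriv_eq_zero
  have hmax : IsLocalMax f 0 := by
    apply isLocalMax_of_deriv_deriv_neg
    · rw [hd, hf'.deriv]; exact hc
    · exact h0
    · exact (hf 0).continuousAt
  have hev : f =ᶠ[𝓝 0] fun _ => f 0 := by
    filter_upwards [hmax] with t ht
    exact le_antisymm ht (hmin t)
  have h2 := hev.deriv.deriv_eq
  rw [hd, hf'.deriv] at h2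
  simp at h2
  linarith

lemma aux_second_max {f f' : ℝ → ℝ} {c : ℝ} (hmax : ∀ t, f t ≤ f 0)
    (hf : ∀ t, HasDerivAt f (f' t) t) (hf' : HasDerivAt f' c 0) : c ≤ 0 := by
  have := aux_second_min (f := fun t => - f t) (f' := fun t => - f' t) (c := -c)
    (fun t => neg_le_neg (hmax t)) (fun t => (hf t).neg) hf'.neg
  linarith

/-- Directional derivative. -/
def ddir {n : ℕ} {F : Type*} [NormedAddCommGroup F] [NormedSpace ℝ F]
    (v : Euc n) (f : Euc n → F) : Euc n → F := fun x => fderiv ℝ f x v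

variable {n : ℕ} {F : Type*} [NormedAddCommGroup F] [NormedSpace ℝ F]

lemma ddir_contDiff (v : Euc n) {f : Euc n → F} (hf : ContDiff ℝ (⊤ : ℕ∞) f) :
    ContDiff ℝ (⊤ : ℕ∞) (ddir v f) := by
  have h : ContDiff ℝ (⊤ : ℕ∞) (fderiv ℝ f) := hf.fderiv_right (by simp)
  exact h.clm_apply contDiff_const

lemma ddir_ddir_eq (v w : Euc n) {f : Euc n → F} (hf : ContDiff ℝ (⊤ : ℕ∞) f) (x : Euc n) :
    ddir v (ddir w f) x = fderiv ℝ (fderiv ℝ f) x v w := by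
  have h : ContDiff ℝ (⊤ : ℕ∞) (fderiv ℝ f) := hf.fderiv_right (by simp)
  have h1 : HasFDerivAt (fderiv ℝ f) (fderiv ℝ (fderiv ℝ f) x) x :=
    (h.differentiable (by simp) x).hasFDerivAt
  have h2 := h1.clm_apply (hasFDerivAt_const w x)
  change fderiv ℝ (fun y => fderiv ℝ f y w) x v = _
  rw [h2.fderiv]
  simp

lemma ddir_comm (v w : Euc n) {f : Euc n → F} (hf : ContDiff ℝ (⊤ : ℕ∞) f) :
    ddir v (ddir w f) = ddir w (ddir v f) := by
  funext x
  rw [ddir_ddir_eq v w hf, ddir_ddir_eq w v hf]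
  have : IsSymmSndFDerivAt ℝ f x :=
    hf.contDiffAt.isSymmSndFDerivAt (by
      rw [minSmoothness_of_isRCLikeNormedField]
      exact WithTop.coe_le_coe.2 le_top)
  exact this.eq v w

lemma ddir_hasDerivAt {f : Euc n → F} (hf : ContDiff ℝ (⊤ : ℕ∞) f) (x v : Euc n) (t : ℝ) :
    HasDerivAt (fun s : ℝ => f (x + s • v)) (ddir v f (x + t • v)) t := by
  have h1 : HasFDerivAt f (fderiv ℝ f (x + t • v)) (x + t • v) :=
    (hf.differentiable (by simp) _).hasFDerivAt
  have h2 : HasDerivAt (fun s : ℝ => x + s • v) v t := by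
    simpa using ((hasDerivAt_id t).smul_const v).const_add x
  exact h1.comp_hasDerivAt t h2

lemma ddir_hasDerivAt_zero {f : Euc n → F} (hf : ContDiff ℝ (⊤ : ℕ∞) f) (x v : Euc n) :
    HasDerivAt (fun s : ℝ => f (x + s • v)) (ddir v f x) 0 := by
  simpa using ddir_hasDerivAt hf x v 0

lemma hess_eq {f : Euc n → ℝ} (hf : ContDiff ℝ (⊤ : ℕ∞) f) (x v : Euc n) :
    hess f x v = ddir v (ddir v f) x := by
  rw [ddir_ddir_eq v v hf, hess, iteratedFDeriv_two_apply]
  simp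

lemma hessMat_eq {f : Euc n → ℝ} (x : Euc n) (i j : Fin n) :
    hessMat f x i j = fderiv ℝ (fderiv ℝ f) x (EuclideanSpace.single i 1)
      (EuclideanSpace.single j 1) := by
  rw [hessMat, Matrix.of_apply, iteratedFDeriv_two_apply]
  simp

lemma hess_toLp (f : Euc n → ℝ) (x : Euc n) (c : Fin n → ℝ) :
    hess f x (WithLp.toLp 2 c) = ∑ i, ∑ j, c i * hessMat f x i j * c j := by
  have hc : (WithLp.toLp 2 c : Euc n) = ∑ i, c i • EuclideanSpace.single i (1 : ℝ) := by
    ext k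
    simp [Pi.single_apply]
  rw [hess, iteratedFDeriv_two_apply, hc]
  simp only [Matrix.cons_val_zero, Matrix.cons_val_one, map_sum, map_smul,
    _root_.sum_apply, _root_.smul_apply, hessMat_eq, smul_eq_mul,
    Finset.mul_sum]
  rw [Finset.sum_comm]
  refine Finset.sum_congr rfl fun i _ => Finset.sum_congr rfl fun j _ => by ring

lemma hess_nonneg_of_convex {f : Euc n → ℝ} (hf : ContDiff ℝ (⊤ : ℕ∞) f)
    (hc : ConvexOn ℝ univ f) (x v : Euc n) : 0 ≤ hess f x v := by
  rw [hess_eq hf]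
  have h1 := ddir_hasDerivAt hf x v
  have h2 := ddir_hasDerivAt_zero (ddir_contDiff v hf) x v
  have hg : ConvexOn ℝ univ (fun s : ℝ => f (x + s • v)) := by
    refine ⟨convex_univ, fun s _ t _ a b ha hb hab => ?_⟩
    have := hc.2 (mem_univ (x + s • v)) (mem_univ (x + t • v)) ha hb hab
    refine le_trans (le_of_eq ?_) this
    change f _ = f _
    congr 1
    have hx : x = a • x + b • x := by rw [← add_smul, hab, one_smul]
    nth_rewrite 1 [hx]
    simp only [smul_eq_mul, add_smul, smul_add, mul_smul]
    abel
  have hm := hg.monotoneOn_deriv (fun t _ => (h1 t).differentiableAt)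
  have hd : deriv (fun s : ℝ => f (x + s • v)) = fun s : ℝ => ddir v f (x + s • v) :=
    funext fun t => (h1 t).deriv
  rw [hd, monotoneOn_univ] at hm
  rw [← h2.deriv]
  exact hm.deriv_nonneg

lemma hessMat_posSemidef {f : Euc n → ℝ} (hf : ContDiff ℝ (⊤ : ℕ∞) f)
    (hc : ConvexOn ℝ univ f) (x : Euc n) : (hessMat f x).PosSemidef := by
  refine Matrix.PosSemidef.of_dotProduct_mulVec_nonneg ?_ fun c => ?_
  · ext i j
    simp only [Matrix.conjTranspose_apply, star_trivial, hessMat_eq]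
    rw [← ddir_ddir_eq _ _ hf, ← ddir_ddir_eq _ _ hf, ddir_comm _ _ hf]
  · have := hess_nonneg_of_convex hf hc x (WithLp.toLp 2 c)
    rw [hess_toLp] at this
    simpa [dotProduct, Matrix.mulVec, Finset.mul_sum, mul_assoc] using this

/-- AM-GM for the determinant. -/
lemma det_le_trace_pow (hn : 1 ≤ n) {M : Matrix (Fin n) (Fin n) ℝ} (hM : M.PosSemidef) :
    M.det ≤ (M.trace / n) ^ n := by
  have hn0 : (0 : ℝ) < n := by exact_mod_cast hn
  have hnn := hM.eigenvalues_nonneg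
  have h := Real.geom_mean_le_arith_mean Finset.univ (fun _ : Fin n => (1 : ℝ))
    hM.1.eigenvalues (by simp) (by simpa using hn0) (fun i _ => hnn i)
  simp only [Real.rpow_one, Finset.sum_const, Finset.card_univ, Fintype.card_fin, nsmul_eq_mul,
    mul_one, one_mul] at h
  have hdet := hM.1.det_eq_prod_eigenvalues
  have htr := hM.1.trace_eq_sum_eigenvalues
  simp only [RCLike.ofReal_real_eq_id, id_eq] at hdet htr
  rw [← hdet, ← htr] at h
  have h2 := pow_le_pow_left₀ (Real.rpow_nonneg hM.det_nonneg _) h n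
  rwa [Real.rpow_inv_natCast_pow hM.det_nonneg (by omega)] at h2

lemma exists_frame {A : Matrix (Fin n) (Fin n) ℝ} (hA : A.PosDef) :
    ∃ B : Matrix (Fin n) (Fin n) ℝ, B.transpose * B = A⁻¹ := by
  open scoped MatrixOrder Matrix.Norms.L2Operator in
  obtain ⟨B, hB⟩ := CStarAlgebra.nonneg_iff_eq_star_mul_self.mp hA.inv.posSemidef.nonneg
  refine ⟨B, ?_⟩
  rw [hB, Matrix.star_eq_conjTranspose, Matrix.conjTranspose_eq_transpose_of_trivial]

lemma trace_conj_eq (f : Euc n → ℝ) (x : Euc n) (B : Matrix (Fin n) (Fin n) ℝ) :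
    (B * hessMat f x * B.transpose).trace = ∑ i, hess f x (WithLp.toLp 2 (B i)) := by
  rw [Matrix.trace]
  refine Finset.sum_congr rfl fun i _ => ?_
  rw [hess_toLp]
  simp only [Matrix.diag_apply, Matrix.mul_apply, Matrix.transpose_apply, Finset.sum_mul]
  rw [Finset.sum_comm]

/-- From a quadratic form maximum to the eigenvector equation. -/
lemma eigen_eq {f : Euc n → ℝ} (hf : ContDiff ℝ (⊤ : ℕ∞) f) (x e : Euc n) (he : ‖e‖ = 1)
    (hmax : ∀ v : Euc n, ‖v‖ = 1 → hess f x v ≤ hess f x e) (w : Euc n) :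
    ddir e (ddir w f) x = hess f x e * ⟪e, w⟫ := by
  set H := fderiv ℝ (fderiv ℝ f) x with hH
  have hh : ∀ v, hess f x v = H v v := fun v => by rw [hess_eq hf, ddir_ddir_eq _ _ hf]
  have hsym : ∀ v u, H v u = H u v := fun v u => by
    rw [← ddir_ddir_eq _ _ hf, ← ddir_ddir_eq _ _ hf, ddir_comm _ _ hf]
  have hq : ∀ v, H v v ≤ H e e * ‖v‖ ^ 2 := by
    intro v
    by_cases hv : v = 0
    · simp [hv]
    have hv' : ‖v‖ ≠ 0 := by simpa using hv
    have := hmax (‖v‖⁻¹ • v) (by rw [norm_smul, norm_inv, norm_norm, inv_mul_cancel₀ hv'])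
    rw [hh, hh] at this
    simp only [map_smul, _root_.smul_apply, smul_eq_mul] at this
    have h2 := mul_le_mul_of_nonneg_right this (sq_nonneg ‖v‖)
    refine le_trans (le_of_eq ?_) h2
    field_simp
  rw [ddir_ddir_eq _ _ hf, hh, ← hH]
  have key : ∀ s : ℝ, 0 ≤ s * (2 * (H e e * ⟪e, w⟫ - H e w))
      + s ^ 2 * (H e e * ‖w‖ ^ 2 - H w w) := by
    intro s
    have h := hq (e + s • w)
    rw [norm_add_sq_real, norm_smul, he, real_inner_smul_right] at h
    simp only [map_add, map_smul, _root_.add_apply, _root_.smul_apply,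
      smul_eq_mul, Real.norm_eq_abs, mul_pow, sq_abs] at h
    rw [hsym w e] at h
    nlinarith
  have hd : HasDerivAt (fun s : ℝ => s * (2 * (H e e * ⟪e, w⟫ - H e w))
      + s ^ 2 * (H e e * ‖w‖ ^ 2 - H w w)) (2 * (H e e * ⟪e, w⟫ - H e w)) 0 := by
    have := ((hasDerivAt_id (0 : ℝ)).mul_const (2 * (H e e * ⟪e, w⟫ - H e w))).add
      (((hasDerivAt_id (0 : ℝ)).pow 2).mul_const (H e e * ‖w‖ ^ 2 - H w w))
    simpa using! this
  have hm : IsLocalMin (fun s : ℝ => s * (2 * (H e e * ⟪e, w⟫ - H e w))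
      + s ^ 2 * (H e e * ‖w‖ ^ 2 - H w w)) 0 :=
    Filter.Eventually.of_forall fun s => by simpa using key s
  have := hm.hasDerivAt_eq_zero hd
  linarith

lemma gradient_contDiff {f : Euc n → ℝ} (hf : ContDiff ℝ (⊤ : ℕ∞) f) :
    ContDiff ℝ (⊤ : ℕ∞) (gradient f) := by
  have h : ContDiff ℝ (⊤ : ℕ∞) (fderiv ℝ f) := hf.fderiv_right (by simp)
  exact (InnerProductSpace.toDual ℝ (Euc n)).symm.contDiff.comp h

lemma ddir_inner {G : Euc n → Euc n} (hG : ContDiff ℝ (⊤ : ℕ∞) G) (v w x : Euc n) :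
    ⟪ddir v G x, w⟫ = ddir v (fun y => ⟪G y, w⟫) x := by
  have h1 := (hG.differentiable (by simp) x).hasFDerivAt
  have h2 := h1.inner ℝ (hasFDerivAt_const w x)
  rw [ddir, ddir, h2.fderiv]
  simp

lemma theta_hasDerivAt {p : ℝ} (hp : 0 < p) {w : ℝ → ℝ} {w' t : ℝ} (hw : HasDerivAt w w' t)
    (hpos : 0 < p + w t) :
    HasDerivAt (fun s => Theta p (w s)) (p / (p + w t) * w') t := by
  have hne : (1 + w t / p) ≠ 0 := by
    have : 1 + w t / p = (p + w t) / p := by field_simp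
    rw [this]; positivity
  have := (((hw.div_const p).const_add 1).log hne).const_mul p
  refine this.congr_deriv ?_
  have : 1 + w t / p = (p + w t) / p := by field_simp
  rw [this]
  field_simp

lemma theta'_hasDerivAt {p : ℝ} {w w' : ℝ → ℝ} {w'' t : ℝ}
    (hw : HasDerivAt w (w' t) t) (hw' : HasDerivAt w' w'' t) (hpos : 0 < p + w t) :
    HasDerivAt (fun s => p / (p + w s) * w' s)
      (p / (p + w t) * w'' - p / (p + w t) ^ 2 * w' t ^ 2) t := by
  have h1 := ((hasDerivAt_const t p).div (hw.const_add p) hpos.ne').mul hw'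
  refine h1.congr_deriv ?_
  simp only [Pi.div_apply]
  field_simp
  ring

/-- Pointwise consequence of the Monge-Ampere equation and the AM-GM inequality. -/
lemma ma_solve {d : ℝ} (hd : 0 < d) {z δ R : ℝ} (hz : 0 < z) (hδ : 0 ≤ δ)
    (h : z ^ (1 / d) * δ ^ (1 / d) = Real.exp (R / d)) : 0 < δ ∧ z * δ = Real.exp R := by
  have h1 : (z * δ) ^ (1 / d) = Real.exp (R / d) := by
    rw [Real.mul_rpow hz.le hδ, h]
  have hδ' : 0 < δ := by
    rcases hδ.lt_or_eq with h' | h'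
    · exact h'
    · exfalso
      rw [← h', mul_zero, Real.zero_rpow (by positivity)] at h1
      exact (Real.exp_pos _).ne h1
  refine ⟨hδ', ?_⟩
  have h2 := congrArg (fun y => y ^ d) h1
  rwa [← Real.rpow_mul (by positivity), one_div_mul_cancel hd.ne', Real.rpow_one,
    ← Real.exp_mul, div_mul_cancel₀ _ hd.ne'] at h2

end SecondVariationHelpers

/-- **Two-parameter second-variation inequality at a Hessian maximum.** -/
theorem two_parameter_second_variation
    {n : ℕ} (hn : 1 ≤ n) (d D : ℝ) (hnd : (n : ℝ) ≤ d) (hdD : d ≤ D)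
    (V W : Euc n → ℝ) (hVreg : ContDiff ℝ (⊤ : ℕ∞) V) (hWreg : ContDiff ℝ (⊤ : ℕ∞) W)
    (hVlow : ∀ x, -d < V x) (hWlow : ∀ y, -D < W y)
    (ZV ZW : ℝ) (hZV : 0 < ZV) (hZW : 0 < ZW)
    (φ : Euc n → ℝ) (hφreg : ContDiff ℝ (⊤ : ℕ∞) φ) (hφconv : ConvexOn ℝ univ φ)
    (hMA : ∀ x : Euc n, (ZV / ZW) ^ (1 / d) * (hessMat φ x).det ^ (1 / d)
      = Real.exp ((Theta D (W (gradient φ x)) - Theta d (V x)) / d))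
    (xbar e1 : Euc n) (he1 : ‖e1‖ = 1)
    (hmax : ∀ (x e : Euc n), ‖e‖ = 1 → hess φ x e ≤ hess φ xbar e1)
    (ybar : Euc n) (hybar : ybar = gradient φ xbar)
    (l V1 V11 W1 W11 Vb Wb : ℝ)
    (hl : l = hess φ xbar e1)
    (hV1 : V1 = ⟪gradient V xbar, e1⟫) (hV11 : V11 = hess V xbar e1)
    (hW1 : W1 = ⟪gradient W ybar, e1⟫) (hW11 : W11 = hess W ybar e1)
    (hVb : Vb = V xbar) (hWb : Wb = W ybar) :
    0 ≥ D / (D + Wb) * W11 * l ^ 2 - d / (d + Vb) * V11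
      + 2 * d / (d + Vb) ^ 2 * V1 ^ 2
      + D * (D - d) / (d * (D + Wb) ^ 2) * W1 ^ 2 * l ^ 2
      - 2 * D / ((d + Vb) * (D + Wb)) * V1 * W1 * l := by
  have hn0 : (0 : ℝ) < n := by exact_mod_cast hn
  have hd : 0 < d := lt_of_lt_of_le hn0 hnd
  have hD : 0 < D := lt_of_lt_of_le hd hdD
  have hz : 0 < ZV / ZW := div_pos hZV hZW
  set G : Euc n → Euc n := gradient φ with hGdef
  have hG : ContDiff ℝ (⊤ : ℕ∞) G := gradient_contDiff hφreg
  have hGinner : ∀ w : Euc n, (fun y => ⟪G y, w⟫) = ddir w φ := fun w => by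
    funext y
    simp [hGdef, ddir]
  set R : Euc n → ℝ := fun x => Theta D (W (G x)) - Theta d (V x) with hR
  have hpsd := hessMat_posSemidef hφreg hφconv
  have hsol : ∀ x, 0 < (hessMat φ x).det ∧ ZV / ZW * (hessMat φ x).det = Real.exp (R x) :=
    fun x => ma_solve hd hz (hpsd x).det_nonneg (hMA x)
  have hpd : (hessMat φ xbar).PosDef :=
    (hpsd xbar).posDef_iff_det_ne_zero.2 (hsol xbar).1.ne'
  obtain ⟨B, hB⟩ := exists_frame hpd
  -- the comparison function
  let w : Fin n → Euc n := fun i => WithLp.toLp 2 (B i)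
  let q : Euc n → ℝ := fun x => (∑ i, hess φ x (w i)) / n
  have hdetB : B.det * B.det = ((hessMat φ xbar).det)⁻¹ := by
    have := congrArg Matrix.det hB
    rwa [Matrix.det_mul, Matrix.det_transpose, Matrix.det_nonsing_inv,
      Ring.inverse_eq_inv'] at this
  have hqn : ∀ x, 0 ≤ q x := fun x =>
    div_nonneg (Finset.sum_nonneg fun i _ => hess_nonneg_of_convex hφreg hφconv x _) hn0.le
  have hqle : ∀ x, Real.exp ((R x - R xbar) / n) ≤ q x := by
    intro x
    have hM : (B * hessMat φ x * B.transpose).PosSemidef := by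
      have := (hpsd x).mul_mul_conjTranspose_same B
      rwa [Matrix.conjTranspose_eq_transpose_of_trivial] at this
    have h1 := det_le_trace_pow hn hM
    rw [trace_conj_eq, Matrix.det_mul, Matrix.det_mul, Matrix.det_transpose] at h1
    have h2 : B.det * (hessMat φ x).det * B.det = Real.exp ((R x - R xbar) / n) ^ n := by
      rw [← Real.exp_nat_mul, mul_div_cancel₀ _ hn0.ne', Real.exp_sub, ← (hsol x).2,
        ← (hsol xbar).2]
      have h3 : B.det * (hessMat φ x).det * B.det = (hessMat φ x).det * (B.det * B.det) := by
        ring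
      rw [h3, hdetB]
      have := (hsol xbar).1.ne'
      field_simp
    rw [h2] at h1
    exact le_of_pow_le_pow_left₀ (by omega) (hqn x) h1
  have hq0 : q xbar = 1 := by
    have h1 := trace_conj_eq φ xbar B
    have h2 : (B * hessMat φ xbar * B.transpose).trace = n := by
      rw [Matrix.mul_assoc, Matrix.trace_mul_comm, Matrix.mul_assoc, hB,
        Matrix.mul_nonsing_inv _ (hsol xbar).1.ne'.isUnit]
      simp
    change (∑ i, hess φ xbar (w i)) / n = 1
    rw [← h1, h2, div_self hn0.ne']
  -- geometry at the maximum
  have hφ11 : ContDiff ℝ (⊤ : ℕ∞) (ddir e1 (ddir e1 φ)) :=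
    ddir_contDiff _ (ddir_contDiff _ hφreg)
  have hmaxx : ∀ x, ddir e1 (ddir e1 φ) x ≤ ddir e1 (ddir e1 φ) xbar := fun x => by
    rw [← hess_eq hφreg, ← hess_eq hφreg]
    exact hmax x e1 he1
  have hfirst : ∀ v, ddir v (ddir e1 (ddir e1 φ)) xbar = 0 := fun v => by
    have hm : IsLocalMax (ddir e1 (ddir e1 φ)) xbar := Filter.Eventually.of_forall hmaxx
    rw [ddir, hm.fderiv_eq_zero]
    simp
  have hfourth : ∀ v, ddir e1 (ddir e1 (ddir v (ddir v φ))) xbar ≤ 0 := fun v => by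
    have hc : ddir e1 (ddir e1 (ddir v (ddir v φ))) = ddir v (ddir v (ddir e1 (ddir e1 φ))) := by
      rw [ddir_comm e1 v (ddir_contDiff v hφreg), ddir_comm e1 v hφreg,
        ddir_comm e1 v (ddir_contDiff v (ddir_contDiff e1 hφreg)),
        ddir_comm e1 v (ddir_contDiff e1 hφreg)]
    rw [hc]
    exact aux_second_max (f := fun t : ℝ => ddir e1 (ddir e1 φ) (xbar + t • v))
      (fun t => by simpa using hmaxx _) (ddir_hasDerivAt hφ11 xbar v)
      (ddir_hasDerivAt_zero (ddir_contDiff v hφ11) xbar v)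
  have hG1 : ddir e1 G xbar = l • e1 := by
    refine ext_inner_right ℝ fun v => ?_
    rw [ddir_inner hG, hGinner, eigen_eq hφreg xbar e1 he1 (fun v hv => hmax xbar v hv),
      real_inner_smul_left, hl]
  have hG11 : ddir e1 (ddir e1 G) xbar = 0 := by
    refine ext_inner_right ℝ fun v => ?_
    have h1 : (fun y => ⟪ddir e1 G y, v⟫) = ddir e1 (ddir v φ) := by
      funext y
      rw [ddir_inner hG, hGinner]
    rw [ddir_inner (ddir_contDiff e1 hG), h1, ddir_comm e1 v hφreg,
      ddir_comm e1 v (ddir_contDiff e1 hφreg), hfirst, inner_zero_left]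
  -- derivatives along the line
  let c : ℝ → Euc n := fun t => G (xbar + t • e1)
  have hc1 : ∀ t, HasDerivAt c (ddir e1 G (xbar + t • e1)) t := ddir_hasDerivAt hG xbar e1
  have hc2 : HasDerivAt (fun t : ℝ => ddir e1 G (xbar + t • e1)) 0 0 := by
    have := ddir_hasDerivAt_zero (ddir_contDiff e1 hG) xbar e1
    rwa [hG11] at this
  have hc0 : c 0 = ybar := by simp [c, hybar]
  let wf : ℝ → ℝ := fun t => W (c t)
  let wf' : ℝ → ℝ := fun t => fderiv ℝ W (c t) (ddir e1 G (xbar + t • e1))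
  have hw1 : ∀ t, HasDerivAt wf (wf' t) t := fun t =>
    ((hWreg.differentiable (by simp) (c t)).hasFDerivAt).comp_hasDerivAt t (hc1 t)
  have hw0' : wf' 0 = l * W1 := by
    have : wf' 0 = fderiv ℝ W ybar (l • e1) := by
      simp only [wf', hc0, zero_smul, add_zero, hG1]
    rw [this, map_smul, hW1, inner_gradient_left, smul_eq_mul]
  have hw2 : HasDerivAt wf' (l ^ 2 * W11) 0 := by
    have hW' : ContDiff ℝ (⊤ : ℕ∞) (fderiv ℝ W) := hWreg.fderiv_right (by simp)
    have h1 : HasDerivAt (fun t => fderiv ℝ W (c t))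
        (fderiv ℝ (fderiv ℝ W) (c 0) (ddir e1 G (xbar + (0 : ℝ) • e1))) 0 :=
      ((hW'.differentiable (by simp) (c 0)).hasFDerivAt).comp_hasDerivAt 0 (hc1 0)
    have h2 := h1.clm_apply hc2
    refine h2.congr_deriv ?_
    rw [hW11, hess_eq hWreg, ddir_ddir_eq _ _ hWreg, hc0]
    simp only [zero_smul, add_zero, hG1, map_smul, map_zero, _root_.smul_apply, smul_eq_mul]
    ring
  let vf : ℝ → ℝ := fun t => V (xbar + t • e1)
  let vf' : ℝ → ℝ := fun t => ddir e1 V (xbar + t • e1)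
  have hv1 : ∀ t, HasDerivAt vf (vf' t) t := ddir_hasDerivAt hVreg xbar e1
  have hv2 : HasDerivAt vf' V11 0 := by
    rw [hV11, hess_eq hVreg]
    exact ddir_hasDerivAt_zero (ddir_contDiff e1 hVreg) xbar e1
  have hv0' : vf' 0 = V1 := by
    simp [vf', ddir, hV1]
  have hv0 : vf 0 = Vb := by simp [vf, hVb]
  have hw0 : wf 0 = Wb := by simp only [wf, hc0, hWb]
  have hvp : ∀ t, 0 < d + vf t := fun t => by have := hVlow (xbar + t • e1); simp only [vf]; linarith
  have hwp : ∀ t, 0 < D + wf t := fun t => by have := hWlow (c t); simp only [wf]; linarith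
  let r : ℝ → ℝ := fun t => R (xbar + t • e1)
  let r' : ℝ → ℝ := fun t => D / (D + wf t) * wf' t - d / (d + vf t) * vf' t
  have hr1 : ∀ t, HasDerivAt r (r' t) t := fun t =>
    (theta_hasDerivAt hD (hw1 t) (hwp t)).sub (theta_hasDerivAt hd (hv1 t) (hvp t))
  have hr2 := (theta'_hasDerivAt (hw1 0) hw2 (hwp 0)).sub (theta'_hasDerivAt (hv1 0) hv2 (hvp 0))
  rw [hv0, hw0, hv0', hw0'] at hr2
  set r2 := D / (D + Wb) * (l ^ 2 * W11) - D / (D + Wb) ^ 2 * (l * W1) ^ 2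
    - (d / (d + Vb) * V11 - d / (d + Vb) ^ 2 * V1 ^ 2) with hr2def
  have hr2' : HasDerivAt r' r2 0 := hr2
  have hr0' : r' 0 = D / (D + Wb) * (l * W1) - d / (d + Vb) * V1 := by
    simp only [r', hv0, hw0, hv0', hw0']
  have hr0 : r 0 = R xbar := by simp [r]
  -- the comparison function along the line
  let qf' : ℝ → ℝ := fun t => (∑ i, ddir e1 (ddir (w i) (ddir (w i) φ)) (xbar + t • e1)) / n
  let q2 : ℝ := (∑ i, ddir e1 (ddir e1 (ddir (w i) (ddir (w i) φ))) xbar) / n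
  have hcd : ∀ i, ContDiff ℝ (⊤ : ℕ∞) (ddir (w i) (ddir (w i) φ)) := fun i =>
    ddir_contDiff _ (ddir_contDiff _ hφreg)
  have hq1 : ∀ t, HasDerivAt (fun t : ℝ => q (xbar + t • e1)) (qf' t) t := fun t => by
    simp only [q, hess_eq hφreg]
    exact (HasDerivAt.fun_sum fun i _ => ddir_hasDerivAt (hcd i) xbar e1 t).div_const _
  have hq2 : HasDerivAt qf' q2 0 :=
    (HasDerivAt.fun_sum fun i _ =>
      ddir_hasDerivAt_zero (ddir_contDiff e1 (hcd i)) xbar e1).div_const _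
  have hq2le : q2 ≤ 0 :=
    div_nonpos_of_nonpos_of_nonneg (Finset.sum_nonpos fun i _ => hfourth (w i)) hn0.le
  have hE1 : ∀ t, HasDerivAt (fun t => Real.exp ((r t - R xbar) / n))
      (Real.exp ((r t - R xbar) / n) * (r' t / n)) t := fun t =>
    (((hr1 t).sub_const _).div_const _).exp
  have hE2 : HasDerivAt (fun t => Real.exp ((r t - R xbar) / n) * (r' t / n))
      (r' 0 / n * (r' 0 / n) + r2 / n) 0 := by
    refine ((hE1 0).mul (hr2'.div_const _)).congr_deriv ?_
    simp [hr0]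
  have hfin := aux_second_min
    (f := fun t : ℝ => q (xbar + t • e1) - Real.exp ((r t - R xbar) / n))
    (fun t => by
      have := hqle (xbar + t • e1)
      simpa [hq0, hr0, r] using this)
    (fun t => (hq1 t).sub (hE1 t)) (hq2.sub hE2)
  have h4 : r2 + (r' 0) ^ 2 / n ≤ 0 := by
    have h5 : r' 0 / n * (r' 0 / n) + r2 / n ≤ 0 := by linarith
    have h6 : r2 + (r' 0) ^ 2 / n = n * (r' 0 / n * (r' 0 / n) + r2 / n) := by
      field_simp
      ring
    rw [h6]
    exact mul_nonpos_of_nonneg_of_nonpos hn0.le h5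
  have h7 : (r' 0) ^ 2 / d ≤ (r' 0) ^ 2 / n :=
    div_le_div_of_nonneg_left (sq_nonneg _) hn0 hnd
  have h8 : r2 + (r' 0) ^ 2 / d ≤ 0 := by linarith
  have hvp0 : d + Vb ≠ 0 := by rw [← hv0]; exact (hvp 0).ne'
  have hwp0 : D + Wb ≠ 0 := by rw [← hw0]; exact (hwp 0).ne'
  refine ge_iff_le.2 (le_trans (le_of_eq ?_) h8)
  rw [hr0', hr2def]
  field_simp
  ring
end
end

section
/- Local growth estimate for the transport map. Let n ≥ 1 be an integer, d, D reals with n ≤ d ≤ D < ∞, and 0 < R < ∞. Let V, W : ℝⁿ → ℝ be continuous with V > −d and W > −D pointwise and Z_{V,d}, Z_{W,D} finite. Let φ : ℝⁿ → ℝ be convex and differentiable with (∇φ)_# μ_{V,d} = μ_{W,D}. Set s = max{R, √d}, ω_n the Lebesgue volume of the unit ball in ℝⁿ, m_{d,R} = ω_n(3s)ⁿ/(Z_{V,d}·(C⁽⁰⁾_{V,d}(10s))^d)·(1 + 100s²/d)^{−d}, Ψ_{W,D}(r) = μ_{W,D}({y : |y| > r}), and 𝓡_{d,D}(R) = 3·inf{r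 ≥ 0 : Ψ_{W,D}(r) ≤ m_{d,R}}. Then for every x ∈ B_R(0): |∇φ(x)| ≤ 𝓡_{d,D}(R) and (d/D)·(D + |∇φ(x)|²)/(d + |x|²) ≤ 1 + 𝓡_{d,D}(R)²/D. -/
open MeasureTheory Metric Set
open scoped ENNReal RealInnerProductSpace

noncomputable section

lemma aux_convex_ineq {n : ℕ} (φ : Euc n → ℝ) (hc : ConvexOn ℝ univ φ)
    (hd : Differentiable ℝ φ) (x y : Euc n) :
    ⟪gradient φ x, y - x⟫ ≤ φ y - φ x := by
  have hg : ConvexOn ℝ univ (φ ∘ (AffineMap.lineMap x y : ℝ →ᵃ[ℝ] Euc n)) := by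
    simpa using hc.comp_affineMap (AffineMap.lineMap x y : ℝ →ᵃ[ℝ] Euc n)
  have hder : HasDerivAt (φ ∘ (AffineMap.lineMap x y : ℝ →ᵃ[ℝ] Euc n))
      (fderiv ℝ φ x (y - x)) 0 := by
    have h1 : HasDerivAt (AffineMap.lineMap x y : ℝ → Euc n) (y - x) 0 :=
      AffineMap.hasDerivAt_lineMap
    have h2 : HasFDerivAt φ (fderiv ℝ φ x) (AffineMap.lineMap x y (0 : ℝ)) := by
      simpa using (hd x).hasFDerivAt
    exact h2.comp_hasDerivAt _ h1
  have h := hg.le_slope_of_hasDerivAt (mem_univ 0) (mem_univ 1) zero_lt_one hder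
  rw [inner_gradient_left]
  simpa [slope_def_field] using h

lemma aux_mono {n : ℕ} (φ : Euc n → ℝ) (hc : ConvexOn ℝ univ φ)
    (hd : Differentiable ℝ φ) (x y : Euc n) :
    ⟪gradient φ x, y - x⟫ ≤ ⟪gradient φ y, y - x⟫ := by
  have h1 := aux_convex_ineq φ hc hd x y
  have h2 := aux_convex_ineq φ hc hd y x
  have h3 : ⟪gradient φ y, x - y⟫ = - ⟪gradient φ y, y - x⟫ := by
    rw [← inner_neg_right, neg_sub]
  linarith

lemma aux_grad_meas {n : ℕ} (φ : Euc n → ℝ) : Measurable (fun x => gradient φ x) := by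
  unfold gradient
  exact (InnerProductSpace.toDual ℝ (Euc n)).symm.continuous.measurable.comp
    (measurable_fderiv ℝ φ)

lemma aux_lower {n : ℕ} (φ : Euc n → ℝ) (hc : ConvexOn ℝ univ φ)
    (hd : Differentiable ℝ φ) (x y : Euc n) (s : ℝ) (hs : 0 < s)
    (hL : gradient φ x ≠ 0)
    (hy : y ∈ ball (x + (6 * s / ‖gradient φ x‖) • gradient φ x) (3 * s)) :
    ‖gradient φ x‖ / 3 < ‖gradient φ y‖ := by
  set v := gradient φ x with hv
  have hL' : 0 < ‖v‖ := norm_pos_iff.mpr hL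
  set c := (6 * s / ‖v‖) • v with hcdef
  set w := y - (x + c) with hw
  have hwn : ‖w‖ < 3 * s := by rwa [mem_ball, dist_eq_norm] at hy
  have hyx : y - x = c + w := by rw [hw]; abel
  have hcn : ‖c‖ = 6 * s := by
    rw [hcdef, norm_smul, Real.norm_of_nonneg (by positivity)]
    field_simp
  have h1 : ‖y - x‖ < 9 * s := by
    rw [hyx]; linarith [norm_add_le c w]
  have h2 : ⟪v, c⟫ = 6 * s * ‖v‖ := by
    rw [hcdef, real_inner_smul_right, real_inner_self_eq_norm_sq]
    field_simp
  have h3 : -(‖v‖ * ‖w‖) ≤ ⟪v, w⟫ := (abs_le.mp (abs_real_inner_le_norm v w)).1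
  have h4 : 3 * s * ‖v‖ < ⟪v, y - x⟫ := by
    rw [hyx, inner_add_right, h2]
    nlinarith
  have h5 := aux_mono φ hc hd x y
  have h6 := real_inner_le_norm (gradient φ y) (y - x)
  have h7 : ‖gradient φ y‖ * ‖y - x‖ ≤ ‖gradient φ y‖ * (9 * s) :=
    mul_le_mul_of_nonneg_left h1.le (norm_nonneg _)
  rw [← hv] at h5
  have h8 : 3 * s * ‖v‖ < ‖gradient φ y‖ * (9 * s) := by linarith
  by_contra hcon
  push Not at hcon
  have := mul_le_mul_of_nonneg_right hcon (show (0:ℝ) ≤ 9 * s by positivity)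
  linarith

lemma aux_finite {n : ℕ} (U : Euc n → ℝ) (p : ℝ)
    (h : Integrable fun x : Euc n => (1 + U x / p) ^ (-p)) : IsFiniteMeasure (muUP U p) := by
  unfold muUP
  exact isFiniteMeasure_withDensity_ofReal (h.const_mul _).2

lemma aux_Zpos {n : ℕ} (U : Euc n → ℝ) (p : ℝ) (hp : 0 < p) (hU : ∀ x, -p < U x)
    (h : Integrable fun x : Euc n => (1 + U x / p) ^ (-p)) : 0 < Znorm U p := by
  have hpos : ∀ x, 0 < (1 + U x / p) ^ (-p) := fun x => by
    apply Real.rpow_pos_of_pos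
    have := hU x
    have h2 : 1 + U x / p = (p + U x) / p := by field_simp
    rw [h2]
    apply div_pos _ hp
    linarith
  unfold Znorm
  rw [integral_pos_iff_support_of_nonneg (fun x => (hpos x).le) h]
  have : Function.support (fun x : Euc n => (1 + U x / p) ^ (-p)) = univ := by
    ext x; simp [(hpos x).ne']
  rw [this]
  exact isOpen_univ.measure_pos _ univ_nonempty

lemma aux_ratio_bdd {n : ℕ} (U : Euc n → ℝ) (p r : ℝ) (hp : 0 < p) (hU : Continuous U) :
    BddAbove (ratio0 U p '' ball (0 : Euc n) r) := by
  have hc : Continuous (ratio0 U p) := by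
    unfold ratio0
    refine Continuous.div (by fun_prop) (by fun_prop) fun x => by positivity
  exact ((isCompact_closedBall (0 : Euc n) r).bddAbove_image hc.continuousOn).mono
    (image_mono ball_subset_closedBall)

lemma aux_tail {n : ℕ} (μ : Measure (Euc n)) [IsFiniteMeasure μ] (m : ℝ) (hm : 0 < m) :
    ∃ r : ℝ, 0 ≤ r ∧ (μ {y : Euc n | r < ‖y‖}).toReal ≤ m := by
  have h : Filter.Tendsto (fun k : ℕ => μ {y : Euc n | (k : ℝ) < ‖y‖}) Filter.atTop
      (nhds (μ (⋂ k : ℕ, {y : Euc n | (k : ℝ) < ‖y‖}))) := by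
    apply tendsto_measure_iInter_atTop
    · intro k
      exact (measurableSet_lt measurable_const measurable_norm).nullMeasurableSet
    · intro a b hab y hy
      simp only [mem_setOf_eq] at hy ⊢
      exact lt_of_le_of_lt (by exact_mod_cast hab) hy
    · exact ⟨0, measure_ne_top _ _⟩
  have he : (⋂ k : ℕ, {y : Euc n | (k : ℝ) < ‖y‖}) = ∅ := by
    ext y
    simp only [mem_iInter, mem_setOf_eq, mem_empty_iff_false, iff_false, not_forall, not_lt]
    exact exists_nat_ge _
  rw [he, measure_empty] at h
  have h2 := (ENNReal.tendsto_toReal ENNReal.zero_ne_top).comp h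
  obtain ⟨k, hk⟩ := (h2.eventually_lt_const (by simpa using hm)).exists
  exact ⟨k, by positivity, hk.le⟩

lemma aux_mass {n : ℕ} (d s ρ : ℝ) (hd : 0 < d) (hs : 0 < s) (hρ0 : 0 ≤ ρ) (hρ : ρ < 10 * s)
    (V : Euc n → ℝ) (hV : Continuous V) (hVlow : ∀ x, -d < V x)
    (hZV : Integrable fun x : Euc n => (1 + V x / d) ^ (-d)) (c : Euc n)
    (hcb : ∀ y ∈ ball c (3 * s), ‖y‖ ≤ ρ) :
    0 < unitBallVol n * (3 * s) ^ n /
        (Znorm V d * cUp V d (ball (0 : Euc n) (10 * s)) ^ d) * (1 + 100 * s ^ 2 / d) ^ (-d) ∧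
    unitBallVol n * (3 * s) ^ n /
        (Znorm V d * cUp V d (ball (0 : Euc n) (10 * s)) ^ d) * (1 + 100 * s ^ 2 / d) ^ (-d)
      < (muUP V d (ball c (3 * s))).toReal := by
  have hZ := aux_Zpos V d hd hVlow hZV
  set Z := Znorm V d with hZdef
  set C := cUp V d (ball (0 : Euc n) (10 * s)) with hC
  have hle : ∀ y : Euc n, ‖y‖ < 10 * s → ratio0 V d y ≤ C := fun y hy =>
    le_csSup (aux_ratio_bdd V d _ hd hV) (mem_image_of_mem _ (by simpa using hy))
  have hCpos : 0 < C := by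
    refine lt_of_lt_of_le ?_ (hle 0 (by simpa using hs))
    unfold ratio0
    have := hVlow 0
    apply div_pos <;> [linarith; positivity]
  have hω : 0 < unitBallVol n := by
    unfold unitBallVol
    exact ENNReal.toReal_pos (measure_ball_pos _ _ one_pos).ne' measure_ball_lt_top.ne
  haveI := aux_finite V d hZV
  set k' := Z⁻¹ * (C * (1 + ρ ^ 2 / d)) ^ (-d) with hk'
  have hk'pos : 0 < k' := by positivity
  have hdens : ∀ y ∈ ball c (3 * s), k' ≤ Z⁻¹ * (1 + V y / d) ^ (-d) := by
    intro y hy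
    have hyρ := hcb y hy
    have h1 := hle y (by linarith)
    have h2 := hVlow y
    have h3 : 1 + V y / d = (d + V y) / d := by field_simp
    have h4 : 0 < 1 + V y / d := by rw [h3]; apply div_pos _ hd; linarith
    refine mul_le_mul_of_nonneg_left ?_ (by positivity)
    refine Real.rpow_le_rpow_of_nonpos h4 ?_ (by linarith)
    unfold ratio0 at h1
    rw [div_le_iff₀ (by positivity)] at h1
    have h5 : ‖y‖ ^ 2 ≤ ρ ^ 2 := by gcongr
    rw [h3, div_le_iff₀ hd]
    have h6 : C * (1 + ρ ^ 2 / d) * d = C * (d + ρ ^ 2) := by field_simp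
    rw [h6]
    exact h1.trans (by gcongr)
  have hvol : volume (ball c (3 * s)) = ENNReal.ofReal ((3 * s) ^ n * unitBallVol n) := by
    rw [Measure.addHaar_ball_of_pos _ _ (by positivity), ENNReal.ofReal_mul (by positivity)]
    unfold unitBallVol
    rw [ENNReal.ofReal_toReal measure_ball_lt_top.ne]
    simp
  have hmass : k' * ((3 * s) ^ n * unitBallVol n) ≤ (muUP V d (ball c (3 * s))).toReal := by
    rw [← ENNReal.ofReal_le_iff_le_toReal (measure_ne_top _ _), ENNReal.ofReal_mul hk'pos.le,
      ← hvol]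
    unfold muUP
    rw [withDensity_apply _ measurableSet_ball, ← setLIntegral_const]
    exact setLIntegral_mono' measurableSet_ball fun y hy =>
      ENNReal.ofReal_le_ofReal (hdens y hy)
  refine ⟨by positivity, lt_of_lt_of_le ?_ hmass⟩
  have hlt : (1 + 100 * s ^ 2 / d) ^ (-d) < (1 + ρ ^ 2 / d) ^ (-d) := by
    refine Real.rpow_lt_rpow_of_neg (by positivity) ?_ (by linarith)
    have : ρ ^ 2 < 100 * s ^ 2 := by nlinarith
    gcongr
  have hE : k' * ((3 * s) ^ n * unitBallVol n)
      = unitBallVol n * (3 * s) ^ n / (Z * C ^ d) * (1 + ρ ^ 2 / d) ^ (-d) := by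
    rw [hk', Real.mul_rpow hCpos.le (by positivity), Real.rpow_neg hCpos.le d]
    field_simp
  rw [hE]
  exact mul_lt_mul_of_pos_left hlt (by positivity)

/-- **Local growth estimate for the transport map.** -/
theorem local_growth_estimate
    {n : ℕ} (hn : 1 ≤ n) (d D R : ℝ) (hnd : (n : ℝ) ≤ d) (hdD : d ≤ D) (hR : 0 < R)
    (V W : Euc n → ℝ) (hVcont : Continuous V) (hWcont : Continuous W)
    (hVlow : ∀ x, -d < V x) (hWlow : ∀ y, -D < W y)
    (hZV : Integrable fun x : Euc n => (1 + V x / d) ^ (-d))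
    (hZW : Integrable fun y : Euc n => (1 + W y / D) ^ (-D))
    (φ : Euc n → ℝ) (hφconv : ConvexOn ℝ univ φ) (hφdiff : Differentiable ℝ φ)
    (hpush : Measure.map (fun x => gradient φ x) (muUP V d) = muUP W D)
    (s m calR : ℝ) (Ψ : ℝ → ℝ)
    (hs : s = max R (Real.sqrt d))
    (hm : m = unitBallVol n * (3 * s) ^ n /
        (Znorm V d * cUp V d (ball (0 : Euc n) (10 * s)) ^ d) * (1 + 100 * s ^ 2 / d) ^ (-d))
    (hΨ : ∀ r : ℝ, Ψ r = (muUP W D {y : Euc n | r < ‖y‖}).toReal)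
    (hcalR : calR = 3 * sInf {r : ℝ | 0 ≤ r ∧ Ψ r ≤ m}) :
    ∀ x ∈ ball (0 : Euc n) R,
      ‖gradient φ x‖ ≤ calR ∧
        d / D * ((D + ‖gradient φ x‖ ^ 2) / (d + ‖x‖ ^ 2)) ≤ 1 + calR ^ 2 / D := by
  intro x hx
  have hd : 0 < d := lt_of_lt_of_le (by exact_mod_cast hn) hnd
  have hD : 0 < D := lt_of_lt_of_le hd hdD
  have hRs : R ≤ s := hs ▸ le_max_left _ _
  have hs0 : 0 < s := lt_of_lt_of_le hR hRs
  have hxR : ‖x‖ < R := by simpa using hx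
  have hnn := norm_nonneg x
  haveI := aux_finite W D hZW
  have hmpos : 0 < m := by
    rw [hm]
    refine (aux_mass d s (3 * s) hd hs0 (by positivity) (by linarith) V hVcont hVlow hZV 0
      fun y hy => ?_).1
    have : ‖y‖ < 3 * s := by simpa using hy
    exact this.le
  have hne : {r : ℝ | 0 ≤ r ∧ Ψ r ≤ m}.Nonempty := by
    obtain ⟨r, hr0, hr⟩ := aux_tail (muUP W D) m hmpos
    exact ⟨r, hr0, by rw [hΨ]; exact hr⟩
  have hcal0 : 0 ≤ calR := by
    rw [hcalR]
    have := Real.sInf_nonneg (s := {r : ℝ | 0 ≤ r ∧ Ψ r ≤ m}) fun r hr => hr.1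
    positivity
  have key : ‖gradient φ x‖ ≤ calR := by
    by_cases hL : gradient φ x = 0
    · rw [hL, norm_zero]; exact hcal0
    have hLpos : 0 < ‖gradient φ x‖ := norm_pos_iff.mpr hL
    rw [hcalR]
    suffices h : ‖gradient φ x‖ / 3 ≤ sInf {r : ℝ | 0 ≤ r ∧ Ψ r ≤ m} by linarith
    refine le_csInf hne fun r hr => ?_
    by_contra hcon
    push Not at hcon
    set c := x + (6 * s / ‖gradient φ x‖) • gradient φ x with hc
    have hcn : ‖c‖ ≤ ‖x‖ + 6 * s := by
      have h1 : ‖(6 * s / ‖gradient φ x‖) • gradient φ x‖ = 6 * s := by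
        rw [norm_smul, Real.norm_of_nonneg (by positivity)]
        field_simp
      rw [hc]
      exact (norm_add_le _ _).trans (by rw [h1])
    have hmass := (aux_mass d s (‖x‖ + 9 * s) hd hs0 (by positivity) (by linarith) V hVcont
      hVlow hZV c fun y hy => by
        rw [mem_ball, dist_eq_norm] at hy
        have h1 := norm_add_le (y - c) c
        rw [sub_add_cancel] at h1
        linarith).2
    rw [← hm] at hmass
    have hle : (muUP V d (ball c (3 * s))).toReal ≤ Ψ r := by
      rw [hΨ]
      refine ENNReal.toReal_mono (measure_ne_top _ _) ?_
      rw [← hpush, Measure.map_apply (aux_grad_meas φ)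
        (measurableSet_lt measurable_const measurable_norm)]
      refine measure_mono fun y hy => ?_
      exact hcon.trans (aux_lower φ hφconv hφdiff x y s hs0 hL hy)
    linarith [hr.2]
  refine ⟨key, ?_⟩
  have h1 : d / D * ((D + ‖gradient φ x‖ ^ 2) / (d + ‖x‖ ^ 2))
      ≤ d / D * ((D + calR ^ 2) / d) := by
    have h2 : d ≤ d + ‖x‖ ^ 2 := by nlinarith
    gcongr
  refine h1.trans (le_of_eq ?_)
  field_simp
end
end
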